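/- arXiv:2210.08606 — 3 statements merged into one kernel-verified Lean document; each statement's English description precedes it below -/
import Mathlib

section
/- Suppose K : ℝ^p ⇉ ℝ^n is affine and f : ℝ^p × ℝ^n × ℝ^n → ℝ^m is C-concave. Then the function mf = ν + μ is convex on ℝ^p × ℝ^n, and the solution map Equi is convex, i.e. graph Equi is a convex subset of ℝ^p × ℝ^n. -/
/- STATEMENT 5: if K is affine and f is C-concave then mf = ν + μ is convex
   and the solution map Equi is convex (its graph is a convex set). -/

open Filter Topology Metric Set Pointwise ENNReal

noncomputable section

abbrev E (k : ℕ) := EuclideanSpace ℝ (Fin k)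

/-- The auxiliary function ν, with values in `[0,+∞]`. -/
def nuF {p n m : ℕ} (f : E p → E n → E n → E m) (K : E p → Set (E n)) (C : Set (E m))
    (ξ : E p) (x : E n) : ℝ≥0∞ :=
  ⨆ z ∈ K ξ, EMetric.infEdist (f ξ x z) C

/-- The auxiliary merit function mf = ν + μ, with values in `[0,+∞]`. -/
def mfF {p n m : ℕ} (f : E p → E n → E n → E m) (K : E p → Set (E n)) (C : Set (E m))
    (ξ : E p) (x : E n) : ℝ≥0∞ :=
  nuF f K C ξ x + EMetric.infEdist x (K ξ)

/-- The solution map of the parameterized strong vector equilibrium problem. -/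
def equiSet {p n m : ℕ} (f : E p → E n → E n → E m) (K : E p → Set (E n)) (C : Set (E m))
    (ξ : E p) : Set (E n) :=
  {x ∈ K ξ | ∀ z ∈ K ξ, f ξ x z ∈ C}

/-- Affineness of a set-valued map. -/
def SVAffine {p n : ℕ} (K : E p → Set (E n)) : Prop :=
  ∀ ξ₁ ξ₂ : E p, ∀ t ∈ Icc (0 : ℝ) 1,
    K (t • ξ₁ + (1 - t) • ξ₂) = t • K ξ₁ + (1 - t) • K ξ₂

/-- `C`-concavity of the parametric bifunction `f` (as a map of the triple). -/
def CConcaveF {p n m : ℕ} (f : E p → E n → E n → E m) (C : Set (E m)) : Prop :=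
  ∀ (ξ₁ ξ₂ : E p) (x₁ x₂ z₁ z₂ : E n), ∀ t ∈ Icc (0 : ℝ) 1,
    f (t • ξ₁ + (1 - t) • ξ₂) (t • x₁ + (1 - t) • x₂) (t • z₁ + (1 - t) • z₂)
      - t • f ξ₁ x₁ z₁ - (1 - t) • f ξ₂ x₂ z₂ ∈ C

/-- Joint convexity of the distance to a set: if `S` contains the convex combination
`t • S₁ + (1 - t) • S₂`, the distances combine accordingly. -/
theorem infEDist_convexComb_le {V : Type*} [SeminormedAddCommGroup V] [NormedSpace ℝ V]
    {S₁ S₂ S : Set V} (h₁ : S₁.Nonempty) (h₂ : S₂.Nonempty) {t : ℝ} (ht : t ∈ Icc (0 : ℝ) 1)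
    (hS : t • S₁ + (1 - t) • S₂ ⊆ S) (a b : V) :
    infEDist (t • a + (1 - t) • b) S ≤
      ENNReal.ofReal t * infEDist a S₁ + ENNReal.ofReal (1 - t) * infEDist b S₂ := by
  have : Nonempty S₁ := h₁.to_subtype
  have : Nonempty S₂ := h₂.to_subtype
  have edist_smul_eq : ∀ r : ℝ, 0 ≤ r → ∀ u v : V,
      edist (r • u) (r • v) = ENNReal.ofReal r * edist u v := fun r hr u v ↦ by
    rw [edist_dist, edist_dist, dist_smul₀, Real.norm_of_nonneg hr, ENNReal.ofReal_mul hr]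
  simp only [infEDist, iInf_subtype' (p := (· ∈ S₁)), iInf_subtype' (p := (· ∈ S₂))]
  rw [ENNReal.mul_iInf fun h ↦ (ENNReal.ofReal_ne_top h).elim,
    ENNReal.mul_iInf fun h ↦ (ENNReal.ofReal_ne_top h).elim, ENNReal.iInf_add]
  refine le_iInf fun u ↦ ?_
  rw [ENNReal.add_iInf]
  refine le_iInf fun v ↦ ?_
  have hmem : t • (u : V) + (1 - t) • (v : V) ∈ S :=
    hS (add_mem_add (smul_mem_smul_set u.2) (smul_mem_smul_set v.2))
  calc _ ≤ edist (t • a + (1 - t) • b) (t • (u : V) + (1 - t) • (v : V)) := iInf₂_le _ hmem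
    _ ≤ edist (t • a) (t • (u : V)) + edist ((1 - t) • b) ((1 - t) • (v : V)) :=
      edist_add_add_le _ _ _ _
    _ = _ := by rw [edist_smul_eq t ht.1, edist_smul_eq (1 - t) (sub_nonneg.2 ht.2)]

/-- Moving a point along an element of an additively closed set does not increase its distance
to that set. -/
theorem infEDist_add_right_le {V : Type*} [SeminormedAddCommGroup V] {S : Set V}
    (hS : ∀ u ∈ S, ∀ v ∈ S, u + v ∈ S) {c : V} (hc : c ∈ S) (a : V) :
    infEDist (a + c) S ≤ infEDist a S :=
  le_infEDist.2 fun d hd ↦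
    (infEDist_le_edist_of_mem (hS d hd c hc)).trans_eq (edist_add_right a d c)

/-- A convex cone is closed under addition. -/
theorem add_mem_of_convex_cone {V : Type*} [AddCommGroup V] [Module ℝ V] {C : Set V}
    (hconv : Convex ℝ C) (hcone : ∀ c ∈ C, ∀ t : ℝ, 0 ≤ t → t • c ∈ C) :
    ∀ u ∈ C, ∀ v ∈ C, u + v ∈ C := fun u hu v hv ↦ by
  have h := hcone _ (hconv hu hv (a := 1 / 2) (b := 1 / 2) (by norm_num) (by norm_num)
    (by norm_num)) 2 (by norm_num)
  rwa [smul_add, smul_smul, smul_smul, mul_one_div_cancel two_ne_zero, one_smul, one_smul] at h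

theorem statement5 {p n m : ℕ}
    (K : E p → Set (E n)) (C : Set (E m)) (f : E p → E n → E n → E m)
    -- standing assumptions
    (hKgraph : IsClosed {q : E p × E n | q.2 ∈ K q.1})
    (hKdom : ∀ ξ : E p, (K ξ).Nonempty)
    -- C is a nontrivial closed convex pointed cone
    (hCclosed : IsClosed C) (hCconv : Convex ℝ C)
    (hCcone : ∀ c ∈ C, ∀ t : ℝ, 0 ≤ t → t • c ∈ C)
    (hCpointed : C ∩ (-C) = {0}) (hCnontriv : C ≠ {0})
    -- (i) K is affine
    (hKaff : SVAffine K)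
    -- (ii) f is C-concave
    (hfconc : CConcaveF f C) :
    -- mf is convex on ℝ^p × ℝ^n ...
    (∀ (ξ₁ ξ₂ : E p) (x₁ x₂ : E n), ∀ t ∈ Icc (0 : ℝ) 1,
      mfF f K C (t • ξ₁ + (1 - t) • ξ₂) (t • x₁ + (1 - t) • x₂) ≤
        ENNReal.ofReal t * mfF f K C ξ₁ x₁ + ENNReal.ofReal (1 - t) * mfF f K C ξ₂ x₂) ∧
    -- ... and graph Equi is a convex subset of ℝ^p × ℝ^n
    Convex ℝ {q : E p × E n | q.2 ∈ equiSet f K C q.1} := by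
  have hadd := add_mem_of_convex_cone hCconv hCcone
  have h0 : (0 : E m) ∈ C := (hCpointed.symm ▸ mem_singleton (0 : E m) : _ ∈ C ∩ -C).1
  have hsplit : ∀ u v w : E m, w = u + v + (w - u - v) := fun u v w ↦ by abel
  refine ⟨fun ξ₁ ξ₂ x₁ x₂ t ht ↦ ?_, ?_⟩
  · have hμ := infEDist_convexComb_le (hKdom ξ₁) (hKdom ξ₂) ht (hKaff ξ₁ ξ₂ t ht).ge x₁ x₂
    have hν : nuF f K C (t • ξ₁ + (1 - t) • ξ₂) (t • x₁ + (1 - t) • x₂) ≤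
        ENNReal.ofReal t * nuF f K C ξ₁ x₁ + ENNReal.ofReal (1 - t) * nuF f K C ξ₂ x₂ := by
      refine iSup₂_le fun z hz ↦ ?_
      rw [hKaff ξ₁ ξ₂ t ht] at hz
      obtain ⟨_, ⟨z₁, hz₁, rfl⟩, _, ⟨z₂, hz₂, rfl⟩, rfl⟩ := hz
      have hC : t • C + (1 - t) • C ⊆ C := by
        rintro _ ⟨_, ⟨u, hu, rfl⟩, _, ⟨v, hv, rfl⟩, rfl⟩
        exact hCconv hu hv ht.1 (sub_nonneg.2 ht.2) (add_sub_cancel _ _)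
      have hc := hfconc ξ₁ ξ₂ x₁ x₂ z₁ z₂ t ht
      rw [hsplit (t • f ξ₁ x₁ z₁) ((1 - t) • f ξ₂ x₂ z₂) (f _ _ _)]
      refine (infEDist_add_right_le hadd hc _).trans
        ((infEDist_convexComb_le ⟨0, h0⟩ ⟨0, h0⟩ ht hC _ _).trans ?_)
      gcongr
      · exact le_iSup₂ (f := fun z (_ : z ∈ K ξ₁) ↦ infEDist (f ξ₁ x₁ z) C) z₁ hz₁
      · exact le_iSup₂ (f := fun z (_ : z ∈ K ξ₂) ↦ infEDist (f ξ₂ x₂ z) C) z₂ hz₂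
    refine (add_le_add hν hμ).trans_eq ?_
    simp only [mfF, mul_add]
    exact add_add_add_comm _ _ _ _
  · rintro ⟨ξ₁, x₁⟩ ⟨hx₁, h₁⟩ ⟨ξ₂, x₂⟩ ⟨hx₂, h₂⟩ t s ht hs hts
    obtain rfl : s = 1 - t := by linarith
    have htI : t ∈ Icc (0 : ℝ) 1 := ⟨ht, by linarith⟩
    refine ⟨?_, fun z hz ↦ ?_⟩
    · exact (hKaff ξ₁ ξ₂ t htI).ge (add_mem_add (smul_mem_smul_set hx₁) (smul_mem_smul_set hx₂))
    · obtain ⟨_, ⟨z₁, hz₁, rfl⟩, _, ⟨z₂, hz₂, rfl⟩, rfl⟩ := (hKaff ξ₁ ξ₂ t htI).le hz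
      rw [hsplit (t • f ξ₁ x₁ z₁) ((1 - t) • f ξ₂ x₂ z₂) (f _ _ _)]
      exact hadd _ (hadd _ (hCcone _ (h₁ z₁ hz₁) t ht) _ (hCcone _ (h₂ z₂ hz₂) _ hs)) _
        (hfconc ξ₁ ξ₂ x₁ x₂ z₁ z₂ t htI)
end
end

section
/- Let (ξ̄,x̄) ∈ Ω̃ ∩ graph Equi be a local solution to (MPEC). Suppose (i) φ is locally Lipschitz around (ξ̄,x̄); (ii) graph Equi is closed; (iii) Ω̃ and graph Equi are subtransversal at (ξ̄,x̄); (iv) there exist δ, γ > 0 with dist(x, Equi(ξ)) ≤ mf(ξ,x)/γ for all (ξ,x) ∈ B̄(ξ̄,δ) × B̄(x̄,δ). Then there exists λ > 0 such that (ξ̄,x̄) is a local unconstrained minimizer of the function (ξ,x) ↦ φ(ξ,x) + λ( dist(ξ,Ω) + mf(ξ,x)/γ ). -/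
/- STATEMENT 8: reduction of (MPEC) to an unconstrained penalized problem,
   under subtransversality and a uniform error bound. -/

open Filter Topology Metric Set Pointwise ENNReal NNReal

noncomputable section

/-- The graph of the solution map. -/
def equiGraph {p n m : ℕ} (f : E p → E n → E n → E m) (K : E p → Set (E n)) (C : Set (E m)) :
    Set (E p × E n) :=
  {q : E p × E n | q.2 ∈ equiSet f K C q.1}

/-- Subtransversality of a pair of sets at a common point (metric characterization). -/
def Subtransversal {X : Type*} [PseudoMetricSpace X] (S₁ S₂ : Set X) (s : X) : Prop :=
  ∃ κ > (0 : ℝ), ∃ r > (0 : ℝ), ∀ w ∈ Metric.closedBall s r,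
    Metric.infDist w (S₁ ∩ S₂) ≤ κ * max (Metric.infDist w S₁) (Metric.infDist w S₂)

/-- The distance to the product `s ×ˢ univ` is at most the distance to `s` of the first
coordinate. -/
theorem infDist_prod_univ_le {X Y : Type*} [PseudoMetricSpace X] [PseudoMetricSpace Y]
    {s : Set X} (hs : s.Nonempty) (q : X × Y) :
    Metric.infDist q (s ×ˢ (univ : Set Y)) ≤ Metric.infDist q.1 s := by
  refine (Metric.le_infDist hs).2 fun y hy => ?_
  have hmem : (y, q.2) ∈ s ×ˢ (univ : Set Y) := ⟨hy, mem_univ _⟩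
  refine (Metric.infDist_le_dist_of_mem hmem).trans ?_
  simp [Prod.dist_eq]

/-- The distance to a graph is at most the distance to the fibre over the first coordinate,
provided that fibre is nonempty. -/
theorem infDist_graph_le {X Y : Type*} [PseudoMetricSpace X] [PseudoMetricSpace Y]
    {F : X → Set Y} (q : X × Y) (hF : (F q.1).Nonempty) :
    Metric.infDist q {w : X × Y | w.2 ∈ F w.1} ≤ Metric.infDist q.2 (F q.1) := by
  refine (Metric.le_infDist hF).2 fun y hy => ?_
  refine (Metric.infDist_le_dist_of_mem (y := (q.1, y)) hy).trans ?_
  simp [Prod.dist_eq]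

/-- Exact penalization: a local minimizer over a closed set `S` of a function that is Lipschitz
around it locally minimizes the sum of the function and the Lipschitz constant times the distance
to `S`. -/
theorem exists_forall_ball_le_add_mul_infDist {X : Type*} [PseudoMetricSpace X] [ProperSpace X]
    {φ : X → ℝ} {S : Set X} (hS : IsClosed S) {s : X} (hs : s ∈ S) {ρ : ℝ} (hρ : 0 < ρ)
    (hloc : ∀ q ∈ S ∩ Metric.closedBall s ρ, φ s ≤ φ q)
    {ε : ℝ} (hε : 0 < ε) {L : ℝ≥0} (hφ : LipschitzOnWith L φ (Metric.ball s ε)) :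
    ∃ r > (0 : ℝ), ∀ q ∈ Metric.ball s r, φ s ≤ φ q + L * Metric.infDist q S := by
  refine ⟨min ρ ε / 2, by positivity, fun q hq => ?_⟩
  rw [Metric.mem_ball] at hq
  obtain ⟨y, hyS, hy⟩ := hS.exists_infDist_eq_dist ⟨s, hs⟩ q
  have hqy : dist q y ≤ dist q s := hy ▸ Metric.infDist_le_dist_of_mem hs
  have hys : dist y s ≤ dist q y + dist q s := dist_triangle_left y s q
  have hρ' := min_le_left ρ ε
  have hε' := min_le_right ρ ε
  have hmin := hloc y ⟨hyS, by rw [Metric.mem_closedBall]; linarith⟩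
  have hlip := hφ.dist_le_mul y (by rw [Metric.mem_ball]; linarith) q
    (by rw [Metric.mem_ball]; linarith [dist_nonneg (x := q) (y := s)])
  rw [Real.dist_eq, dist_comm y q] at hlip
  rw [hy]
  linarith [le_abs_self (φ y - φ q)]

/-- The merit function vanishes at solutions. -/
theorem mfF_eq_zero {p n m : ℕ} {f : E p → E n → E n → E m} {K : E p → Set (E n)}
    {C : Set (E m)} {ξ : E p} {x : E n} (hx : x ∈ equiSet f K C ξ) : mfF f K C ξ x = 0 := by
  have hν : nuF f K C ξ x = 0 := by
    simp only [nuF, ENNReal.iSup_eq_zero]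
    exact fun z hz => Metric.infEDist_zero_of_mem (hx.2 z hz)
  rw [mfF, hν, zero_add]
  exact Metric.infEDist_zero_of_mem hx.1

theorem statement8 {p n m : ℕ}
    (K : E p → Set (E n)) (C : Set (E m)) (f : E p → E n → E n → E m)
    (φ : E p × E n → ℝ) (Ω : Set (E p)) (hΩ : IsClosed Ω)
    -- standing assumptions
    (hKgraph : IsClosed {q : E p × E n | q.2 ∈ K q.1})
    (hKdom : ∀ ξ : E p, (K ξ).Nonempty)
    -- C is a nontrivial closed convex pointed cone
    (hCclosed : IsClosed C) (hCconv : Convex ℝ C)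
    (hCcone : ∀ c ∈ C, ∀ t : ℝ, 0 ≤ t → t • c ∈ C)
    (hCpointed : C ∩ (-C) = {0}) (hCnontriv : C ≠ {0})
    (ξ' : E p) (x' : E n)
    -- (ξ̄,x̄) ∈ Ω̃ ∩ graph Equi is a local solution to (MPEC)
    (hfeas : (ξ', x') ∈ (Ω ×ˢ (univ : Set (E n))) ∩ equiGraph f K C)
    (hloc : ∃ ρ > (0 : ℝ), ∀ q ∈ (Ω ×ˢ (univ : Set (E n))) ∩ equiGraph f K C ∩
      Metric.closedBall ((ξ', x') : E p × E n) ρ, φ (ξ', x') ≤ φ q)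
    -- (i) φ is locally Lipschitz around (ξ̄,x̄)
    (hφlip : ∃ ε > (0 : ℝ), ∃ L : ℝ≥0,
      LipschitzOnWith L φ (Metric.ball ((ξ', x') : E p × E n) ε))
    -- (ii) graph Equi is closed
    (hgrcl : IsClosed (equiGraph f K C))
    -- (iii) Ω̃ and graph Equi are subtransversal at (ξ̄,x̄)
    (hsub : Subtransversal (Ω ×ˢ (univ : Set (E n))) (equiGraph f K C) (ξ', x'))
    -- (iv) a uniform error bound around (ξ̄,x̄) holds
    (δ γ : ℝ) (hδ : 0 < δ) (hγ : 0 < γ)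
    (herr : ∀ ξ ∈ Metric.closedBall ξ' δ, ∀ x ∈ Metric.closedBall x' δ,
      EMetric.infEdist x (equiSet f K C ξ) ≤ mfF f K C ξ x / ENNReal.ofReal γ) :
    -- conclusion: (ξ̄,x̄) is a local unconstrained minimizer of the penalized function
    ∃ lam > (0 : ℝ), ∃ ε > (0 : ℝ), ∀ q ∈ Metric.ball ((ξ', x') : E p × E n) ε,
      (φ (ξ', x') : EReal) + (lam : EReal) *
          ((Metric.infDist ξ' Ω : EReal) + ((mfF f K C ξ' x' / ENNReal.ofReal γ : ℝ≥0∞) : EReal))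
        ≤ (φ q : EReal) + (lam : EReal) *
          ((Metric.infDist q.1 Ω : EReal) + ((mfF f K C q.1 q.2 / ENNReal.ofReal γ : ℝ≥0∞) : EReal)) := by
  obtain ⟨ρ, hρ, hloc⟩ := hloc
  obtain ⟨ε, hε, L, hφ⟩ := hφlip
  obtain ⟨κ, hκ, r, hr, hsub⟩ := hsub
  have hξ : ξ' ∈ Ω := hfeas.1.1
  obtain ⟨r', hr', hpen⟩ := exists_forall_ball_le_add_mul_infDist
    ((hΩ.prod isClosed_univ).inter hgrcl) hfeas hρ hloc hε hφ
  refine ⟨L * κ + 1, by positivity, min r' (min r δ), by positivity, fun q hq => ?_⟩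
  rw [Metric.mem_ball, lt_min_iff, lt_min_iff] at hq
  obtain ⟨hqr', hqr, hqδ⟩ := hq
  rw [mfF_eq_zero hfeas.2, Metric.infDist_zero_of_mem hξ]
  have herrq := herr q.1 ((le_max_left _ _).trans hqδ.le) q.2 ((le_max_right _ _).trans hqδ.le)
  generalize mfF f K C q.1 q.2 / ENNReal.ofReal γ = M at herrq ⊢
  have hlam : (0 : ℝ) < L * κ + 1 := by positivity
  induction M with
  | top =>
    rw [EReal.coe_ennreal_top, EReal.coe_add_top, EReal.coe_mul_top_of_pos hlam,
      EReal.coe_add_top]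
    exact le_top
  | coe M =>
    have hne : (equiSet f K C q.1).Nonempty := by
      rw [nonempty_iff_ne_empty]
      intro h
      rw [h] at herrq
      exact absurd (Metric.infEDist_empty.symm.trans_le herrq) (not_le.2 coe_lt_top)
    have hM : Metric.infDist q.2 (equiSet f K C q.1) ≤ M := ENNReal.toReal_mono coe_ne_top herrq
    have hgraph : Metric.infDist q (equiGraph f K C) ≤ M := (infDist_graph_le q hne).trans hM
    have hprod := infDist_prod_univ_le (Y := E n) ⟨ξ', hξ⟩ q
    have hd : 0 ≤ Metric.infDist q.1 Ω := Metric.infDist_nonneg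
    have hmax : max (Metric.infDist q (Ω ×ˢ (univ : Set (E n))))
        (Metric.infDist q (equiGraph f K C)) ≤ Metric.infDist q.1 Ω + M :=
      max_le (by linarith [M.coe_nonneg]) (by linarith)
    have hdist := (hsub q hqr.le).trans (mul_le_mul_of_nonneg_left hmax hκ.le)
    have hreal : φ (ξ', x') ≤ φ q + (L * κ + 1) * (Metric.infDist q.1 Ω + M) := by
      have := mul_le_mul_of_nonneg_left hdist L.coe_nonneg
      linarith [hpen q hqr', M.coe_nonneg]
    have hcast : (((M : ℝ≥0∞)) : EReal) = ((M : ℝ) : EReal) := rfl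
    rw [hcast]
    simp only [ENNReal.zero_div, EReal.coe_ennreal_zero, EReal.coe_zero, add_zero, mul_zero]
    exact_mod_cast hreal
end
end

section
/- Lipschitz lower semicontinuity of the solution map: let (ξ̄,x̄) ∈ graph Equi, ρ, γ > 0, and suppose dist(x, Equi(ξ)) ≤ mf(ξ,x)/γ for all x ∈ ℝ^n and all ξ ∈ B̄(ξ̄,ρ). If moreover there exist β > 0 and r > 0 such that mf(ξ,x̄) ≤ β‖ξ − ξ̄‖ for all ξ ∈ B̄(ξ̄,r), then dist(x̄, Equi(ξ)) ≤ (β/γ)‖ξ − ξ̄‖ for all ξ ∈ B̄(ξ̄, min{ρ,r}); in particular the ball B̄(x̄, (β/γ)‖ξ − ξ̄‖) meets Equi(ξ) for all such ξ. -/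
/- STATEMENT 18: Lipschitz lower semicontinuity of the solution map Equi,
   from the error bound and calmness from above of ξ ↦ mf(ξ,x̄). -/

open Filter Topology Metric Set Pointwise ENNReal NNReal

noncomputable section

theorem statement18 {p n m : ℕ}
    (K : E p → Set (E n)) (C : Set (E m)) (f : E p → E n → E n → E m)
    -- standing assumptions
    (hKgraph : IsClosed {q : E p × E n | q.2 ∈ K q.1})
    (hKdom : ∀ ξ : E p, (K ξ).Nonempty)
    -- C is a nontrivial closed convex pointed cone
    (hCclosed : IsClosed C) (hCconv : Convex ℝ C)
    (hCcone : ∀ c ∈ C, ∀ t : ℝ, 0 ≤ t → t • c ∈ C)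
    (hCpointed : C ∩ (-C) = {0}) (hCnontriv : C ≠ {0})
    -- Equi(ξ) is closed for each ξ
    (hEquiClosed : ∀ ξ : E p, IsClosed (equiSet f K C ξ))
    (ξ' : E p) (x' : E n) (hbar : x' ∈ equiSet f K C ξ')
    (ρ γ : ℝ) (hρ : 0 < ρ) (hγ : 0 < γ)
    -- the error bound
    (herr : ∀ ξ ∈ Metric.closedBall ξ' ρ, ∀ x : E n,
      EMetric.infEdist x (equiSet f K C ξ) ≤ mfF f K C ξ x / ENNReal.ofReal γ)
    -- calmness from above of ξ ↦ mf(ξ,x̄) at ξ̄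
    (β r : ℝ) (hβ : 0 < β) (hr : 0 < r)
    (hcalm : ∀ ξ ∈ Metric.closedBall ξ' r,
      mfF f K C ξ x' ≤ ENNReal.ofReal (β * dist ξ ξ')) :
    ∀ ξ ∈ Metric.closedBall ξ' (min ρ r),
      EMetric.infEdist x' (equiSet f K C ξ) ≤ ENNReal.ofReal ((β / γ) * dist ξ ξ') ∧
      (Metric.closedBall x' ((β / γ) * dist ξ ξ') ∩ equiSet f K C ξ).Nonempty := by
  intro ξ hξ
  rw [Metric.mem_closedBall, le_min_iff] at hξ
  have hdist : 0 ≤ (β / γ) * dist ξ ξ' := by positivity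
  have hbound : Metric.infEDist x' (equiSet f K C ξ) ≤ ENNReal.ofReal ((β / γ) * dist ξ ξ') :=
    calc Metric.infEDist x' (equiSet f K C ξ)
        ≤ mfF f K C ξ x' / ENNReal.ofReal γ := herr ξ hξ.1 x'
      _ ≤ ENNReal.ofReal (β * dist ξ ξ') / ENNReal.ofReal γ := by
        gcongr
        exact hcalm ξ hξ.2
      _ = ENNReal.ofReal ((β / γ) * dist ξ ξ') := by
        rw [← ENNReal.ofReal_div_of_pos hγ, div_mul_eq_mul_div]
  refine ⟨hbound, ?_⟩
  have hne : (equiSet f K C ξ).Nonempty := by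
    rw [Set.nonempty_iff_ne_empty]
    intro hempty
    rw [hempty, Metric.infEDist_empty] at hbound
    exact ENNReal.ofReal_ne_top (top_le_iff.mp hbound)
  obtain ⟨y, hy, hxy⟩ := (hEquiClosed ξ).exists_infDist_eq_dist hne x'
  refine ⟨y, ?_, hy⟩
  rw [Metric.mem_closedBall, dist_comm, ← hxy]
  exact ENNReal.toReal_le_of_le_ofReal hdist hbound
end
end
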